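/- Let m ≥ 3 be an integer and let V : ℝ → ℝ be (m+2)-times continuously differentiable with V(x) = c₊ x^{-m} for all x ≥ x₊ and V(x) = c₋ |x|^{-m} for all x ≤ x₋ (for some constants c₊, c₋ ∈ ℝ and x₋ < -1 < 1 < x₊). Then for every ε ∈ ℂ with Re ε > 0 there exists a unique solution y₊(·;ε) of y'' = (V + ε²) y on all of ℝ with e^{εx} y₊(x;ε) → 1 as x → +∞, and a unique solution y₋(·;ε) with e^{-εx} y₋(x;ε) → 1 as x → −∞. Moreover, for each fixed x ∈ ℝ, the maps ε ↦ y₊(x;ε) and ε ↦ y₋(x;ε) are analytic on {Re ε > 0}. -/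

import Mathlib

open Filter Set Real

/-- `y` (with derivative `yd`) solves `y'' = (V + ε²) y` on all of `ℝ`. -/
def SolvesHom (V : ℝ → ℝ) (ε : ℂ) (y yd : ℝ → ℂ) : Prop :=
  ∀ x : ℝ, HasDerivAt y (yd x) x ∧
    HasDerivAt yd (((V x : ℂ) + ε ^ 2) * y x) x

section JostSolutions

open MeasureTheory

theorem hasDerivAt_integral_Ioi {E : Type*} [NormedAddCommGroup E] [NormedSpace ℝ E]
    [CompleteSpace E] {f : ℝ → E} (hf : Continuous f)
    (hint : ∀ x, IntegrableOn f (Ioi x)) (x : ℝ) :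
    HasDerivAt (fun x => ∫ t in Ioi x, f t) (-f x) x := by
  have h : (fun x => ∫ t in Ioi x, f t) = fun x => (∫ t in Ioi 0, f t) - ∫ t in 0..x, f t := by
    funext x
    rw [← intervalIntegral.integral_Ioi_sub_Ioi' (hint 0) (hint x)]
    abel
  rw [h]
  exact (intervalIntegral.integral_hasDerivAt_right (hf.intervalIntegrable _ _)
    (hf.stronglyMeasurableAtFilter _ _) hf.continuousAt).const_sub _

/-- The tail `∫_x^∞ |V|` of a potential. -/
noncomputable def potentialTail (V : ℝ → ℝ) (x : ℝ) : ℝ := ∫ t in Ioi x, |V t|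

theorem potentialTail_nonneg (V : ℝ → ℝ) (x : ℝ) : 0 ≤ potentialTail V x :=
  integral_nonneg fun _ => abs_nonneg _

theorem tendsto_potentialTail (V : ℝ → ℝ) :
    Tendsto (potentialTail V) atTop (nhds 0) :=
  tendsto_integral_Ioi_zero tendsto_id

theorem potentialTail_anti {V : ℝ → ℝ} (hVi : Integrable V) {x y : ℝ} (h : x ≤ y) :
    potentialTail V y ≤ potentialTail V x :=
  setIntegral_mono_set hVi.abs.integrableOn (ae_of_all _ fun _ => abs_nonneg _)
    (Ioi_subset_Ioi h).eventuallyLE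

theorem hasDerivAt_potentialTail {V : ℝ → ℝ} (hV : Continuous V) (hVi : Integrable V) (x : ℝ) :
    HasDerivAt (potentialTail V) (-|V x|) x :=
  hasDerivAt_integral_Ioi hV.abs (fun _ => hVi.abs.integrableOn) x

theorem integral_abs_mul_potentialTail_pow {V : ℝ → ℝ} (hV : Continuous V) (hVi : Integrable V)
    (n : ℕ) (x : ℝ) :
    IntegrableOn (fun t => |V t| * potentialTail V t ^ n) (Ioi x) ∧
      ∫ t in Ioi x, |V t| * potentialTail V t ^ n = potentialTail V x ^ (n + 1) / (n + 1) := by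
  have hd : ∀ t ∈ Ici x, HasDerivAt (fun t => -(potentialTail V t ^ (n + 1) / (n + 1)))
      (|V t| * potentialTail V t ^ n) t := by
    intro t _
    convert! (((hasDerivAt_potentialTail hV hVi t).pow (n + 1)).div_const ((n : ℝ) + 1)).neg using 1
    have : (n : ℝ) + 1 ≠ 0 := by positivity
    push_cast
    field_simp
  have hl : Tendsto (fun t => -(potentialTail V t ^ (n + 1) / ((n : ℝ) + 1))) atTop (nhds 0) := by
    simpa using (((tendsto_potentialTail V).pow (n + 1)).div_const ((n : ℝ) + 1)).neg
  have hi := integrableOn_Ioi_deriv_of_nonneg' hd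
    (fun t _ => mul_nonneg (abs_nonneg _) (pow_nonneg (potentialTail_nonneg V t) n)) hl
  refine ⟨hi, ?_⟩
  rw [integral_Ioi_of_hasDerivAt_of_tendsto' hd hi hl]
  ring

/-- The Volterra operator inverting `u'' - 2 ε u' = V f` with decay at `+∞`. -/
noncomputable def jostVolterra (V : ℝ → ℝ) (ε : ℂ) (f : ℝ → ℂ) (x : ℝ) : ℂ :=
  ∫ t in Ioi x, (1 - Complex.exp (-(2 * ε * (t - x)))) / (2 * ε) * (V t * f t)

theorem norm_jostKernel_le {ε : ℂ} (hε : 0 < ε.re) {x t : ℝ} (h : x ≤ t) :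
    ‖(1 - Complex.exp (-(2 * ε * (t - x)))) / (2 * ε)‖ ≤ 1 / ‖ε‖ := by
  have hne : ε ≠ 0 := by rintro rfl; simp at hε
  have hpos : 0 < ‖ε‖ := norm_pos_iff.2 hne
  have he : ‖Complex.exp (-(2 * ε * (t - x)))‖ ≤ 1 := by
    rw [Complex.norm_exp, Real.exp_le_one_iff]
    have : (-(2 * ε * ((t : ℂ) - x))).re = -(2 * ε.re * (t - x)) := by
      simp [Complex.mul_re]
    rw [this]
    have := mul_nonneg hε.le (sub_nonneg.2 h)
    linarith
  rw [norm_div, norm_mul, Complex.norm_ofNat, div_le_div_iff₀ (by positivity) hpos]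
  have h2 : ‖1 - Complex.exp (-(2 * ε * (t - x)))‖ ≤ 2 := by
    have := norm_sub_le (1 : ℂ) (Complex.exp (-(2 * ε * (t - x))))
    rw [norm_one] at this
    linarith
  nlinarith

theorem norm_jostVolterra_le {V : ℝ → ℝ} (hV : Continuous V) (hVi : Integrable V) {ε : ℂ}
    (hε : 0 < ε.re) {f : ℝ → ℂ} {M x : ℝ} {n : ℕ}
    (hf : ∀ t, x < t → ‖f t‖ ≤ M * potentialTail V t ^ n) :
    ‖jostVolterra V ε f x‖ ≤ M / ‖ε‖ * (potentialTail V x ^ (n + 1) / (n + 1)) := by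
  obtain ⟨hi, he⟩ := integral_abs_mul_potentialTail_pow hV hVi n x
  rw [← he, ← integral_const_mul]
  refine norm_integral_le_of_norm_le (hi.const_mul _) ?_
  refine (ae_restrict_mem measurableSet_Ioi).mono fun t ht => ?_
  rw [norm_mul, norm_mul, Complex.norm_real, Real.norm_eq_abs]
  calc _ ≤ 1 / ‖ε‖ * (|V t| * (M * potentialTail V t ^ n)) := by
        gcongr
        · exact norm_jostKernel_le hε (le_of_lt ht)
        · exact hf t ht
    _ = _ := by ring

theorem integrableOn_exp_mul {ε : ℂ} (hε : 0 < ε.re) {g : ℝ → ℂ} {x : ℝ}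
    (hg : IntegrableOn g (Ioi x)) :
    IntegrableOn (fun t : ℝ => Complex.exp (-(2 * ε * t)) * g t) (Ioi x) := by
  refine Integrable.bdd_mul (c := Real.exp (-(2 * ε.re * x))) hg
    (by fun_prop) ?_
  refine (ae_restrict_mem measurableSet_Ioi).mono fun t ht => ?_
  rw [Complex.norm_exp, Real.exp_le_exp]
  have : (-(2 * ε * (t : ℂ))).re = -(2 * ε.re * t) := by
    simp [Complex.mul_re]
  rw [this]
  have := mul_le_mul_of_nonneg_left (le_of_lt ht) hε.le
  linarith

theorem jostVolterra_eq {V : ℝ → ℝ} {ε : ℂ} (hε : 0 < ε.re) {f : ℝ → ℂ} {x : ℝ}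
    (hf : IntegrableOn (fun t => V t * f t) (Ioi x)) :
    jostVolterra V ε f x = ((∫ t in Ioi x, V t * f t) - Complex.exp (2 * ε * x) *
      ∫ t in Ioi x, Complex.exp (-(2 * ε * t)) * (V t * f t)) / (2 * ε) := by
  rw [← integral_const_mul, ← integral_sub hf ((integrableOn_exp_mul hε hf).const_mul _),
    ← integral_div]
  refine integral_congr_ae (ae_of_all _ fun t => ?_)
  have : Complex.exp (-(2 * ε * (t - x))) =
      Complex.exp (2 * ε * x) * Complex.exp (-(2 * ε * t)) := by
    rw [← Complex.exp_add]; congr 1; ring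
  simp only [this]
  ring

theorem continuous_jostVolterra {V : ℝ → ℝ} (hV : Continuous V) {ε : ℂ} (hε : 0 < ε.re)
    {f : ℝ → ℂ} (hfc : Continuous f)
    (hf : ∀ x, IntegrableOn (fun t => V t * f t) (Ioi x)) :
    Continuous (jostVolterra V ε f) := by
  rw [show jostVolterra V ε f = _ from funext fun x => jostVolterra_eq hε (hf x)]
  have h1 : Continuous fun x => ∫ t in Ioi x, (V t : ℂ) * f t :=
    continuous_iff_continuousAt.2 fun x =>
      (hasDerivAt_integral_Ioi (by fun_prop) hf x).continuousAt
  have h2 : Continuous fun x : ℝ => ∫ t in Ioi x, Complex.exp (-(2 * ε * t)) * ((V t : ℂ) * f t) :=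
    continuous_iff_continuousAt.2 fun x =>
      (hasDerivAt_integral_Ioi (by fun_prop) (fun x => integrableOn_exp_mul hε (hf x))
        x).continuousAt
  fun_prop

theorem differentiableOn_integral_of_dominated {α : Type*} [MeasurableSpace α] {μ : Measure α}
    {U : Set ℂ} (hU : IsOpen U) {F : ℂ → α → ℂ} {bound : α → ℝ}
    (hm : ∀ z ∈ U, AEStronglyMeasurable (F z) μ)
    (hb : ∀ᵐ a ∂μ, ∀ z ∈ U, ‖F z a‖ ≤ bound a) (hbi : Integrable bound μ)
    (hd : ∀ᵐ a ∂μ, DifferentiableOn ℂ (fun z => F z a) U) :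
    DifferentiableOn ℂ (fun z => ∫ a, F z a ∂μ) U := by
  intro z₀ hz₀
  obtain ⟨r, hr, hball⟩ := Metric.isOpen_iff.1 hU z₀ hz₀
  have hr2 : 0 < r / 2 := by positivity
  set z : ℕ → ℂ := fun n => z₀ + ((r / (n + 2) : ℝ) : ℂ) with hz
  have hzU : ∀ n, z n ∈ U := fun n => hball <| by
    have h2 : (1 : ℝ) < n + 2 := by have := n.cast_nonneg (α := ℝ); linarith
    rw [Metric.mem_ball, dist_eq_norm, hz, add_sub_cancel_left, Complex.norm_real,
      Real.norm_of_nonneg (by positivity)]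
    exact div_lt_self hr h2
  have hzne : ∀ n, z n ≠ z₀ := fun n h => by
    have : ((r / (n + 2) : ℝ) : ℂ) ≠ 0 := Complex.ofReal_ne_zero.2 (by positivity)
    exact this <| add_eq_left.1 h
  have hzlim : Tendsto z atTop (nhdsWithin z₀ {z₀}ᶜ) := by
    refine tendsto_nhdsWithin_iff.2 ⟨?_, Eventually.of_forall hzne⟩
    have h1 : Tendsto (fun n : ℕ => r / ((n : ℝ) + 2)) atTop (nhds 0) :=
      tendsto_const_nhds.div_atTop (tendsto_natCast_atTop_atTop.atTop_add tendsto_const_nhds)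
    simpa [hz] using ((Complex.continuous_ofReal.tendsto 0).comp h1).const_add z₀
  have hderiv : AEStronglyMeasurable (fun a => deriv (fun z => F z a) z₀) μ := by
    refine aestronglyMeasurable_of_tendsto_ae atTop
      (f := fun n a => slope (fun z => F z a) z₀ (z n)) (fun n => ?_) ?_
    · exact ((hm _ (hzU n)).sub (hm _ hz₀)).const_smul (z n - z₀)⁻¹
    · filter_upwards [hd] with a ha
      exact (hasDerivAt_iff_tendsto_slope.1
        (ha.differentiableAt (hU.mem_nhds hz₀)).hasDerivAt).comp hzlim
  refine (hasDerivAt_integral_of_dominated_loc_of_deriv_le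
    (F' := fun w a => deriv (fun z => F z a) w) (bound := fun a => bound a / (r / 2))
    (Metric.ball_mem_nhds z₀ hr2)
    ((hU.mem_nhds hz₀ |> eventually_of_mem) hm)
    (hbi.mono' (hm _ hz₀) (hb.mono fun a ha => ha _ hz₀)) hderiv ?_ (hbi.div_const _)
    ?_).2.differentiableAt.differentiableWithinAt
  · filter_upwards [hb, hd] with a ha hda w hw
    have hsub : Metric.closedBall w (r / 2) ⊆ U := fun v hv => hball <| by
      have h1 := Metric.mem_closedBall.1 hv
      have h2 := Metric.mem_ball.1 hw
      have := dist_triangle v w z₀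
      rw [Metric.mem_ball]; linarith
    refine Complex.norm_deriv_le_of_forall_mem_sphere_norm_le hr2 ?_
      fun v hv => ha v (hsub (Metric.sphere_subset_closedBall hv))
    exact (hda.mono hsub).diffContOnCl_ball subset_rfl
  · filter_upwards [hd] with a ha w hw
    exact (ha.differentiableAt (hU.mem_nhds
      (hball (Metric.ball_subset_ball (by linarith) hw)))).hasDerivAt

theorem norm_jostVolterra_le_factorial {V : ℝ → ℝ} (hV : Continuous V) (hVi : Integrable V)
    {ε : ℂ} (hε : 0 < ε.re) {f : ℝ → ℂ} {M x : ℝ} {n : ℕ}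
    (hf : ∀ t, x < t → ‖f t‖ ≤ M * ((potentialTail V t / ‖ε‖) ^ n / n.factorial)) :
    ‖jostVolterra V ε f x‖ ≤
      M * ((potentialTail V x / ‖ε‖) ^ (n + 1) / (n + 1).factorial) := by
  refine (norm_jostVolterra_le hV hVi hε (M := M / (‖ε‖ ^ n * n.factorial)) (n := n)
    fun t ht => (hf t ht).trans_eq ?_).trans_eq ?_
  · rw [div_pow]; ring
  · rw [Nat.factorial_succ, div_pow]
    push_cast
    rw [pow_succ ‖ε‖]
    field_simp

/-- The Picard iterates whose sum is the normalized Jost solution `e^{εx} y₊(x; ε)`. -/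
noncomputable def jostIterate (V : ℝ → ℝ) (ε : ℂ) : ℕ → ℝ → ℂ
  | 0 => fun _ => 1
  | n + 1 => jostVolterra V ε (jostIterate V ε n)

theorem potentialTail_le {V : ℝ → ℝ} (hVi : Integrable V) (x : ℝ) :
    potentialTail V x ≤ ∫ t, |V t| :=
  setIntegral_le_integral hVi.abs (ae_of_all _ fun _ => abs_nonneg _)

theorem norm_jostIterate_le_tail {V : ℝ → ℝ} (hV : Continuous V) (hVi : Integrable V)
    {ε : ℂ} (hε : 0 < ε.re) (n : ℕ) (x : ℝ) :
    ‖jostIterate V ε n x‖ ≤ (potentialTail V x / ‖ε‖) ^ n / n.factorial := by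
  induction n generalizing x with
  | zero => simp [jostIterate]
  | succ n ih =>
    simpa only [one_mul, jostIterate] using norm_jostVolterra_le_factorial hV hVi hε (M := 1)
      fun t _ => (ih t).trans_eq (one_mul _).symm

theorem norm_jostIterate_le {V : ℝ → ℝ} (hV : Continuous V) (hVi : Integrable V)
    {ε : ℂ} {δ : ℝ} (hδ : 0 < δ) (hε : δ ≤ ε.re) (n : ℕ) (x : ℝ) :
    ‖jostIterate V ε n x‖ ≤ ((∫ t, |V t|) / δ) ^ n / n.factorial := by
  have h0 := potentialTail_nonneg V x
  refine (norm_jostIterate_le_tail hV hVi (hδ.trans_le hε) n x).trans ?_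
  gcongr
  · exact potentialTail_le hVi x
  · exact hε.trans (Complex.re_le_norm ε)

theorem integrableOn_mul_of_bounded {V : ℝ → ℝ} (hVi : Integrable V) {f : ℝ → ℂ}
    (hf : Continuous f) {C x : ℝ} (hC : ∀ t, x < t → ‖f t‖ ≤ C) :
    IntegrableOn (fun t => V t * f t) (Ioi x) :=
  hVi.ofReal.integrableOn.mul_bdd hf.aestronglyMeasurable
    ((ae_restrict_mem measurableSet_Ioi).mono hC)

theorem continuous_jostIterate {V : ℝ → ℝ} (hV : Continuous V) (hVi : Integrable V)
    {ε : ℂ} (hε : 0 < ε.re) (n : ℕ) : Continuous (jostIterate V ε n) := by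
  induction n with
  | zero => exact continuous_const
  | succ n ih =>
    exact continuous_jostVolterra hV hε ih fun x =>
      integrableOn_mul_of_bounded hVi ih fun t _ => norm_jostIterate_le hV hVi hε le_rfl n t

theorem differentiableOn_jostIterate {V : ℝ → ℝ} (hV : Continuous V) (hVi : Integrable V)
    {δ : ℝ} (hδ : 0 < δ) (n : ℕ) (x : ℝ) :
    DifferentiableOn ℂ (fun ε => jostIterate V ε n x) {ε | δ < ε.re} := by
  induction n generalizing x with
  | zero => exact differentiableOn_const _
  | succ n ih =>
    refine differentiableOn_integral_of_dominated
      (bound := fun t => 1 / δ * (|V t| * (((∫ t, |V t|) / δ) ^ n / n.factorial)))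
      (isOpen_lt continuous_const Complex.continuous_re) (fun ε hε => ?_) ?_
      ((hVi.abs.mul_const _).const_mul _).integrableOn (ae_of_all _ fun t ε hε => ?_)
    · have := continuous_jostIterate hV hVi (hδ.trans hε) n
      exact Continuous.aestronglyMeasurable (by fun_prop)
    · refine (ae_restrict_mem measurableSet_Ioi).mono fun t ht ε hε => ?_
      rw [norm_mul, norm_mul, Complex.norm_real, Real.norm_eq_abs]
      gcongr
      · refine (norm_jostKernel_le (hδ.trans hε) (le_of_lt ht)).trans ?_
        exact one_div_le_one_div_of_le hδ ((le_of_lt hε).trans (Complex.re_le_norm ε))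
      · exact norm_jostIterate_le hV hVi hδ (le_of_lt hε) n t
    · have hne : 2 * ε ≠ 0 := by
        have : 0 < ε.re := hδ.trans hε
        rintro h
        obtain rfl : ε = 0 := by simpa using h
        simp at this
      have h := ih t ε hε
      have hk : DifferentiableWithinAt ℂ
          (fun ε : ℂ => (1 - Complex.exp (-(2 * ε * (t - x)))) / (2 * ε)) {ε | δ < ε.re} ε :=
        DifferentiableWithinAt.div (by fun_prop) (by fun_prop) hne
      exact hk.mul (h.const_mul _)

/-- The normalized Jost solution `e^{εx} y₊(x; ε)`. -/
noncomputable def jostProfile (V : ℝ → ℝ) (ε : ℂ) (x : ℝ) : ℂ := ∑' n, jostIterate V ε n x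

theorem norm_jostProfile_le {V : ℝ → ℝ} (hV : Continuous V) (hVi : Integrable V)
    {ε : ℂ} (hε : 0 < ε.re) (x : ℝ) :
    ‖jostProfile V ε x‖ ≤ ∑' n : ℕ, ((∫ t, |V t|) / ε.re) ^ n / n.factorial :=
  tsum_of_norm_bounded (Real.summable_pow_div_factorial _).hasSum
    fun n => norm_jostIterate_le hV hVi hε le_rfl n x

theorem continuous_jostProfile {V : ℝ → ℝ} (hV : Continuous V) (hVi : Integrable V)
    {ε : ℂ} (hε : 0 < ε.re) : Continuous (jostProfile V ε) :=
  continuous_tsum (continuous_jostIterate hV hVi hε) (Real.summable_pow_div_factorial _)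
    fun n x => norm_jostIterate_le hV hVi hε le_rfl n x

theorem analyticOnNhd_jostProfile {V : ℝ → ℝ} (hV : Continuous V) (hVi : Integrable V) (x : ℝ) :
    AnalyticOnNhd ℂ (fun ε => jostProfile V ε x) {ε | 0 < ε.re} := by
  refine DifferentiableOn.analyticOnNhd (fun ε hε => ?_)
    (isOpen_lt continuous_const Complex.continuous_re)
  have hδ : 0 < ε.re / 2 := half_pos hε
  have hU : IsOpen {z : ℂ | ε.re / 2 < z.re} := isOpen_lt continuous_const Complex.continuous_re
  have h := Complex.differentiableOn_tsum_of_summable_norm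
    (Real.summable_pow_div_factorial ((∫ t, |V t|) / (ε.re / 2)))
    (fun n => differentiableOn_jostIterate hV hVi hδ n x) hU
    fun n w hw => norm_jostIterate_le hV hVi hδ (le_of_lt hw) n x
  exact (h.differentiableAt (hU.mem_nhds (half_lt_self (mem_ofPred_eq ▸ hε)))).differentiableWithinAt

theorem jostProfile_eq {V : ℝ → ℝ} (hV : Continuous V) (hVi : Integrable V)
    {ε : ℂ} (hε : 0 < ε.re) (x : ℝ) :
    jostProfile V ε x = 1 + jostVolterra V ε (jostProfile V ε) x := by
  have hs : ∀ t, Summable fun n => jostIterate V ε n t := fun t =>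
    Summable.of_norm_bounded (Real.summable_pow_div_factorial _)
      fun n => norm_jostIterate_le hV hVi hε le_rfl n t
  have hb := Real.summable_pow_div_factorial ((∫ t, |V t|) / ε.re)
  have h : HasSum (fun n => jostIterate V ε (n + 1) x)
      (jostVolterra V ε (jostProfile V ε) x) := by
    refine hasSum_integral_of_dominated_convergence
      (fun n t => 1 / ‖ε‖ * |V t| * (((∫ t, |V t|) / ε.re) ^ n / n.factorial)) (fun n => ?_)
      (fun n => ?_) (ae_of_all _ fun t => hb.mul_left _) ?_ (ae_of_all _ fun t => ?_)
    · have := continuous_jostIterate hV hVi hε n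
      exact Continuous.aestronglyMeasurable (by fun_prop)
    · refine (ae_restrict_mem measurableSet_Ioi).mono fun t ht => ?_
      rw [norm_mul, norm_mul, Complex.norm_real, Real.norm_eq_abs, ← mul_assoc]
      gcongr
      · exact norm_jostKernel_le hε (le_of_lt ht)
      · exact norm_jostIterate_le hV hVi hε le_rfl n t
    · simp only [tsum_mul_left]
      exact ((hVi.abs.const_mul _).mul_const _).integrableOn
    · exact ((hs t).hasSum.mul_left _).mul_left _
  rw [← h.tsum_eq, jostProfile, (hs x).tsum_eq_zero_add]
  rfl

theorem tendsto_jostProfile {V : ℝ → ℝ} (hV : Continuous V) (hVi : Integrable V)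
    {ε : ℂ} (hε : 0 < ε.re) : Tendsto (jostProfile V ε) atTop (nhds 1) := by
  rw [tendsto_iff_norm_sub_tendsto_zero]
  set C := ∑' n : ℕ, ((∫ t, |V t|) / ε.re) ^ n / n.factorial
  refine squeeze_zero (g := fun x => C * (potentialTail V x / ‖ε‖)) (fun _ => norm_nonneg _)
    (fun x => ?_) (by simpa using ((tendsto_potentialTail V).div_const ‖ε‖).const_mul C)
  rw [jostProfile_eq hV hVi hε, add_sub_cancel_left]
  simpa using norm_jostVolterra_le_factorial hV hVi hε (n := 0) (M := C) (x := x)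
    fun t _ => by simpa using norm_jostProfile_le hV hVi hε t

/-- The Jost solution at `+∞`. -/
noncomputable def jostSolution (V : ℝ → ℝ) (ε : ℂ) (x : ℝ) : ℂ :=
  Complex.exp (-(ε * x)) * jostProfile V ε x

theorem exists_solvesHom_jostSolution {V : ℝ → ℝ} (hV : Continuous V) (hVi : Integrable V)
    {ε : ℂ} (hε : 0 < ε.re) : ∃ yd, SolvesHom V ε (jostSolution V ε) yd := by
  have hne : ε ≠ 0 := by rintro rfl; simp at hε
  have hu := continuous_jostProfile hV hVi hε
  have hi : ∀ x, IntegrableOn (fun t => V t * jostProfile V ε t) (Ioi x) := fun x =>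
    integrableOn_mul_of_bounded hVi hu fun t _ => norm_jostProfile_le hV hVi hε t
  set G : ℝ → ℂ := fun x => ∫ t in Ioi x, V t * jostProfile V ε t
  set H : ℝ → ℂ := fun x =>
    ∫ t in Ioi x, Complex.exp (-(2 * ε * t)) * (V t * jostProfile V ε t)
  have hG : ∀ x, HasDerivAt G (-(V x * jostProfile V ε x)) x := fun x =>
    hasDerivAt_integral_Ioi (by fun_prop) hi x
  have hH : ∀ x : ℝ, HasDerivAt H
      (-(Complex.exp (-(2 * ε * x)) * (V x * jostProfile V ε x))) x := fun x =>
    hasDerivAt_integral_Ioi (by fun_prop) (fun x => integrableOn_exp_mul hε (hi x)) x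
  have hexp : ∀ (c : ℂ) (x : ℝ),
      HasDerivAt (fun x : ℝ => Complex.exp (c * x)) (c * Complex.exp (c * x)) x := fun c x => by
    have := ((hasDerivAt_id x).ofReal_comp.const_mul c).cexp
    simpa [mul_comm] using this
  have hsplit : ∀ x : ℝ, Complex.exp (-ε * x) = Complex.exp (ε * x) * Complex.exp (-(2 * ε * x)) :=
    fun x => by rw [← Complex.exp_add]; congr 1; ring
  have hinv : ∀ x : ℝ, Complex.exp (-ε * x) * Complex.exp (2 * ε * x) = Complex.exp (ε * x) :=
    fun x => by rw [← Complex.exp_add]; congr 1; ring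
  have hprof : ∀ x : ℝ, jostProfile V ε x =
      1 + (G x - Complex.exp (2 * ε * x) * H x) / (2 * ε) := fun x => by
    rw [jostProfile_eq hV hVi hε, jostVolterra_eq hε (hi x)]
  have hform : jostSolution V ε = fun x : ℝ =>
      Complex.exp (-ε * x) * (1 + G x / (2 * ε)) - Complex.exp (ε * x) * (H x / (2 * ε)) := by
    funext x
    rw [jostSolution, hprof, ← hinv x, neg_mul]
    ring
  refine ⟨fun x => -ε * Complex.exp (-ε * x) * (1 + G x / (2 * ε)) -
    ε * Complex.exp (ε * x) * (H x / (2 * ε)), fun x => ⟨?_, ?_⟩⟩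
  · rw [hform]
    convert! ((hexp (-ε) x).mul (((hG x).div_const (2 * ε)).const_add 1)).sub
      ((hexp ε x).mul ((hH x).div_const (2 * ε))) using 1
    simp only [hsplit]
    field_simp
    ring
  · convert! (((hexp (-ε) x).const_mul (-ε)).mul (((hG x).div_const (2 * ε)).const_add 1)).sub
      (((hexp ε x).const_mul ε).mul ((hH x).div_const (2 * ε))) using 1
    have h1 : (V x : ℂ) * jostSolution V ε x =
        Complex.exp (-ε * x) * (V x * jostProfile V ε x) := by
      rw [jostSolution, neg_mul]; ring
    rw [add_mul, h1, hform]
    simp only [hsplit x]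
    field_simp
    ring

theorem SolvesHom.sub {V : ℝ → ℝ} {ε : ℂ} {y yd z zd : ℝ → ℂ} (hy : SolvesHom V ε y yd)
    (hz : SolvesHom V ε z zd) :
    SolvesHom V ε (fun x => y x - z x) (fun x => yd x - zd x) := fun x =>
  ⟨(hy x).1.sub (hz x).1, by
    convert! (hy x).2.sub (hz x).2 using 1
    ring⟩

theorem SolvesHom.comp_neg {V : ℝ → ℝ} {ε : ℂ} {y yd : ℝ → ℂ} (hy : SolvesHom V ε y yd) :
    SolvesHom (fun x => V (-x)) ε (fun x => y (-x)) (fun x => -yd (-x)) := fun x =>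
  ⟨by simpa [Function.comp_def] using (hy (-x)).1.scomp x (hasDerivAt_neg x),
   by simpa [Function.comp_def] using ((hy (-x)).2.scomp x (hasDerivAt_neg x)).fun_neg⟩

/-- A bounded fixed point of the homogeneous Volterra equation on `[x, ∞)` vanishes. -/
theorem eq_zero_of_eq_jostVolterra {V : ℝ → ℝ} (hV : Continuous V) (hVi : Integrable V)
    {ε : ℂ} (hε : 0 < ε.re) {w : ℝ → ℂ} {M x : ℝ} (hM : ∀ t, x ≤ t → ‖w t‖ ≤ M)
    (hw : ∀ t, x ≤ t → w t = jostVolterra V ε w t) : w x = 0 := by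
  have h : ∀ n : ℕ, ∀ t, x ≤ t →
      ‖w t‖ ≤ M * ((potentialTail V t / ‖ε‖) ^ n / n.factorial) := by
    intro n
    induction n with
    | zero => simpa using hM
    | succ n ih =>
      intro t ht
      rw [hw t ht]
      exact norm_jostVolterra_le_factorial hV hVi hε fun s hs => ih s (ht.trans hs.le)
  have hl := (FloorSemiring.tendsto_pow_div_factorial_atTop (potentialTail V x / ‖ε‖)).const_mul M
  rw [mul_zero] at hl
  exact norm_le_zero_iff.1 (ge_of_tendsto' hl fun n => h n x le_rfl)

theorem exists_bound_Ici {w : ℝ → ℂ} (hw : Continuous w) {l : ℂ}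
    (hl : Tendsto w atTop (nhds l)) (x : ℝ) : ∃ M, ∀ t, x ≤ t → ‖w t‖ ≤ M := by
  obtain ⟨N, hN⟩ := eventually_atTop.1 (hl.norm.eventually_le_const (lt_add_one ‖l‖))
  obtain ⟨C, hC⟩ := (isCompact_Icc (a := x) (b := N)).exists_bound_of_continuousOn hw.continuousOn
  refine ⟨max (‖l‖ + 1) C, fun t ht => ?_⟩
  rcases le_total N t with h | h
  · exact (hN t h).trans (le_max_left _ _)
  · exact (hC t ⟨ht, h⟩).trans (le_max_right _ _)

theorem SolvesHom.eq_zero {V : ℝ → ℝ} (hV : Continuous V) (hVi : Integrable V)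
    {ε : ℂ} (hε : 0 < ε.re) {z zd : ℝ → ℂ} (hz : SolvesHom V ε z zd)
    (hl : Tendsto (fun x : ℝ => Complex.exp (ε * x) * z x) atTop (nhds 0)) (x : ℝ) :
    z x = 0 := by
  have hne : ε ≠ 0 := by rintro rfl; simp at hε
  set w : ℝ → ℂ := fun x => Complex.exp (ε * x) * z x with hwdef
  set wd : ℝ → ℂ := fun x => Complex.exp (ε * x) * (ε * z x + zd x) with hwddef
  have hexp : ∀ (c : ℂ) (x : ℝ),
      HasDerivAt (fun x : ℝ => Complex.exp (c * x)) (c * Complex.exp (c * x)) x := fun c x => by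
    have := ((hasDerivAt_id x).ofReal_comp.const_mul c).cexp
    simpa [mul_comm] using this
  have hw : ∀ x, HasDerivAt w (wd x) x := fun x => by
    convert! (hexp ε x).mul (hz x).1 using 1
    simp only [hwddef]; ring
  have hwd : ∀ x, HasDerivAt wd (2 * ε * wd x + V x * w x) x := fun x => by
    convert! (hexp ε x).mul (((hz x).1.const_mul ε).add (hz x).2) using 1
    simp only [hwddef, hwdef, Pi.add_apply]; ring
  have hwc : Continuous w := continuous_iff_continuousAt.2 fun x => (hw x).continuousAt
  have hi : ∀ x, IntegrableOn (fun t => V t * w t) (Ioi x) := fun x => by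
    obtain ⟨M, hM⟩ := exists_bound_Ici hwc hl x
    exact integrableOn_mul_of_bounded hVi hwc fun t ht => hM t ht.le
  set D : ℝ → ℂ := fun x => w x - wd x / (2 * ε) with hDdef
  have hD : ∀ x, HasDerivAt D (-(V x * w x) / (2 * ε)) x := fun x => by
    convert! (hw x).sub ((hwd x).div_const (2 * ε)) using 1
    field_simp
    ring
  have hDi : ∀ x, IntegrableOn (fun t => -(V t * w t) / (2 * ε)) (Ioi x) := fun x =>
    (hi x).neg.div_const _
  obtain ⟨l, hDl⟩ : ∃ l, Tendsto D atTop (nhds l) :=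
    ⟨_, tendsto_limUnder_of_hasDerivAt_of_integrableOn_Ioi (a := 0) (fun x _ => hD x) (hDi 0)⟩
  have hwdD : ∀ x, wd x = 2 * ε * (w x - D x) := fun x => by
    simp only [hDdef]; field_simp; ring
  have hwdl : Tendsto wd atTop (nhds (2 * ε * (0 - l))) := by
    rw [funext hwdD]
    exact (hl.sub hDl).const_mul _
  have hexp0 : Tendsto (fun x : ℝ => Complex.exp (-(2 * ε) * x)) atTop (nhds 0) := by
    rw [tendsto_zero_iff_norm_tendsto_zero]
    have : (fun x : ℝ => ‖Complex.exp (-(2 * ε) * x)‖) = fun x => Real.exp (-(2 * ε.re * x)) := by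
      funext x
      rw [Complex.norm_exp]
      simp [Complex.mul_re]
    rw [this]
    exact Real.tendsto_exp_neg_atTop_nhds_zero.comp
      (tendsto_id.const_mul_atTop (by positivity : 0 < 2 * ε.re))
  have hwdint : ∀ x : ℝ, Complex.exp (-(2 * ε) * x) * wd x =
      -∫ t in Ioi x, Complex.exp (-(2 * ε * t)) * (V t * w t) := fun x => by
    have h := integral_Ioi_of_hasDerivAt_of_tendsto'
      (f := fun x : ℝ => Complex.exp (-(2 * ε) * x) * wd x) (a := x) (m := 0)
      (f' := fun t : ℝ => Complex.exp (-(2 * ε * t)) * (V t * w t))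
      (fun t _ => by
        convert! (hexp (-(2 * ε)) t).mul (hwd t) using 1
        rw [neg_mul (2 * ε) (t : ℂ)]
        ring) (integrableOn_exp_mul hε (hi x)) (by simpa using hexp0.mul hwdl)
    rw [h]; ring
  have hwdeq : ∀ x : ℝ, wd x = -(Complex.exp (2 * ε * x) *
      ∫ t in Ioi x, Complex.exp (-(2 * ε * t)) * (V t * w t)) := fun x => by
    rw [← mul_neg, ← hwdint, ← mul_assoc, ← Complex.exp_add]
    simp
  have hl0 : l = 0 := by
    obtain ⟨M, hM⟩ := exists_bound_Ici hwc hl 0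
    have h0 : Tendsto wd atTop (nhds 0) := by
      refine squeeze_zero_norm' (a := fun x => M * potentialTail V x) ?_
        (by simpa using (tendsto_potentialTail V).const_mul M)
      filter_upwards [eventually_ge_atTop 0] with x hx
      rw [hwdeq, norm_neg, ← integral_const_mul, potentialTail, ← integral_const_mul]
      refine norm_integral_le_of_norm_le (hVi.abs.const_mul M).integrableOn ?_
      refine (ae_restrict_mem measurableSet_Ioi).mono fun t ht => ?_
      have ht' : x < t := ht
      rw [← mul_assoc, ← Complex.exp_add, norm_mul, norm_mul, Complex.norm_real,
        Real.norm_eq_abs, Complex.norm_exp]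
      have h1 : (2 * ε * (x : ℂ) + -(2 * ε * t)).re = -(2 * ε.re * (t - x)) := by
        simp [Complex.mul_re]; ring
      have h2 : Real.exp (2 * ε * (x : ℂ) + -(2 * ε * t)).re ≤ 1 := by
        rw [h1, Real.exp_le_one_iff]
        have := mul_pos hε (sub_pos.2 ht')
        linarith
      calc _ ≤ 1 * (|V t| * M) := by
            gcongr
            exact hM t (hx.trans ht'.le)
        _ = _ := by ring
    have := tendsto_nhds_unique hwdl h0
    simpa [hne] using this
  have hDint : ∀ x, D x = (∫ t in Ioi x, V t * w t) / (2 * ε) := fun x => by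
    have h := integral_Ioi_of_hasDerivAt_of_tendsto' (fun t _ => hD t) (hDi x) hDl
    rw [hl0, integral_div, integral_neg] at h
    linear_combination h
  obtain ⟨M, hM⟩ := exists_bound_Ici hwc hl x
  have hw0 : w x = 0 := eq_zero_of_eq_jostVolterra hV hVi hε hM fun t _ => by
    rw [jostVolterra_eq hε (hi t), sub_div, ← hDint, sub_eq_add_neg, ← neg_div, ← hwdeq]
    simp only [hDdef]; ring
  simpa [hwdef, Complex.exp_ne_zero] using hw0

theorem tendsto_exp_mul_jostSolution {V : ℝ → ℝ} (hV : Continuous V) (hVi : Integrable V)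
    {ε : ℂ} (hε : 0 < ε.re) :
    Tendsto (fun x : ℝ => Complex.exp (ε * x) * jostSolution V ε x) atTop (nhds 1) := by
  refine (tendsto_jostProfile hV hVi hε).congr fun x => ?_
  rw [jostSolution, ← mul_assoc, ← Complex.exp_add]
  simp

theorem SolvesHom.eq_jostSolution {V : ℝ → ℝ} (hV : Continuous V) (hVi : Integrable V)
    {ε : ℂ} (hε : 0 < ε.re) {y yd : ℝ → ℂ} (hy : SolvesHom V ε y yd)
    (hl : Tendsto (fun x : ℝ => Complex.exp (ε * x) * y x) atTop (nhds 1)) :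
    y = jostSolution V ε := by
  obtain ⟨zd, hz⟩ := exists_solvesHom_jostSolution hV hVi hε
  funext x
  refine sub_eq_zero.1 ((hy.sub hz).eq_zero hV hVi hε ?_ x)
  simpa [mul_sub] using hl.sub (tendsto_exp_mul_jostSolution hV hVi hε)

theorem analyticOnNhd_jostSolution {V : ℝ → ℝ} (hV : Continuous V) (hVi : Integrable V) (x : ℝ) :
    AnalyticOnNhd ℂ (fun ε => jostSolution V ε x) {ε | 0 < ε.re} := by
  have h : AnalyticOnNhd ℂ (fun ε : ℂ => Complex.exp (-(ε * x))) {ε | 0 < ε.re} := fun ε _ =>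
    (show Differentiable ℂ fun ε : ℂ => Complex.exp (-(ε * x)) by fun_prop).analyticAt ε
  exact h.mul (analyticOnNhd_jostProfile hV hVi x)

theorem integrableOn_Ioi_of_eq_div_pow {V : ℝ → ℝ} (hV : Continuous V) {m : ℕ} (hm : 2 ≤ m)
    {c a : ℝ} (ha : 0 < a) (h : ∀ x, a ≤ x → V x = c / x ^ m) : IntegrableOn V (Ioi 0) := by
  have h1 : IntegrableOn V (Ioi a) := by
    have hm' : (2 : ℝ) ≤ m := by exact_mod_cast hm
    refine IntegrableOn.congr_fun (Integrable.const_mul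
      (integrableOn_Ioi_rpow_of_lt (a := -(m : ℝ)) (by linarith) ha) c)
      (fun x hx => ?_) measurableSet_Ioi
    have hx' : a < x := hx
    rw [h x hx'.le, Real.rpow_neg (ha.trans hx').le, Real.rpow_natCast, div_eq_mul_inv]
  rw [← Ioc_union_Ioi_eq_Ioi ha.le]
  exact (hV.integrableOn_Ioc).union h1

theorem integrable_of_eq_div_pow {V : ℝ → ℝ} (hV : Continuous V) {m : ℕ} (hm : 2 ≤ m)
    {c d a b : ℝ} (ha : 0 < a) (hb : b < 0) (h : ∀ x, a ≤ x → V x = c / x ^ m)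
    (h' : ∀ x, x ≤ b → V x = d / |x| ^ m) : Integrable V := by
  have h1 := integrableOn_Ioi_of_eq_div_pow hV hm ha h
  have h2 : IntegrableOn (fun x => V (-x)) (Ioi 0) :=
    integrableOn_Ioi_of_eq_div_pow (by fun_prop) hm (neg_pos.2 hb) (c := d) fun x hx => by
      rw [h' _ (by linarith), abs_neg, abs_of_pos (by linarith)]
  have h3 : IntegrableOn V (Iio 0) := by
    simpa using h2.comp_neg
  rw [← integrableOn_univ, ← Iic_union_Ioi (a := (0 : ℝ))]
  exact ((integrableOn_Iic_iff_integrableOn_Iio (by simp)).2 h3).union h1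

end JostSolutions

/-- existence, uniqueness and analyticity in `ε` of the Jost solutions
`y₊`, `y₋` of `y'' = (V + ε²)y` normalized by `e^{εx} y₊ → 1` at `+∞` and
`e^{-εx} y₋ → 1` at `−∞`. -/
theorem stmt10
    (m : ℕ) (hm : 3 ≤ m)
    (V : ℝ → ℝ) (hVsmooth : ContDiff ℝ (m + 2) V)
    (cP cM xP xM : ℝ) (hxM : xM < -1) (hxP : 1 < xP)
    (hVp : ∀ x : ℝ, xP ≤ x → V x = cP / x ^ m)
    (hVm : ∀ x : ℝ, x ≤ xM → V x = cM / |x| ^ m) :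
    ∃ yp ym : ℂ → ℝ → ℂ,
      (∀ ε : ℂ, 0 < ε.re →
        (∃ ypd : ℝ → ℂ, SolvesHom V ε (yp ε) ypd ∧
          Tendsto (fun x : ℝ => Complex.exp (ε * x) * yp ε x) atTop (nhds 1)) ∧
        (∀ y yd : ℝ → ℂ, SolvesHom V ε y yd →
          Tendsto (fun x : ℝ => Complex.exp (ε * x) * y x) atTop (nhds 1) →
          y = yp ε)) ∧
      (∀ ε : ℂ, 0 < ε.re →
        (∃ ymd : ℝ → ℂ, SolvesHom V ε (ym ε) ymd ∧
          Tendsto (fun x : ℝ => Complex.exp (-ε * x) * ym ε x) atBot (nhds 1)) ∧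
        (∀ y yd : ℝ → ℂ, SolvesHom V ε y yd →
          Tendsto (fun x : ℝ => Complex.exp (-ε * x) * y x) atBot (nhds 1) →
          y = ym ε)) ∧
      (∀ x : ℝ,
        AnalyticOnNhd ℂ (fun ε => yp ε x) {ε : ℂ | 0 < ε.re} ∧
        AnalyticOnNhd ℂ (fun ε => ym ε x) {ε : ℂ | 0 < ε.re}) := by
  have hV : Continuous V := hVsmooth.continuous
  have hVi : MeasureTheory.Integrable V :=
    integrable_of_eq_div_pow hV (by lia) (by linarith) (by linarith) hVp hVm
  have hW : Continuous fun x => V (-x) := by fun_prop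
  have hWi : MeasureTheory.Integrable fun x => V (-x) := hVi.comp_neg
  refine ⟨jostSolution V, fun ε x => jostSolution (fun x => V (-x)) ε (-x),
    fun ε hε => ⟨?_, fun y yd hy hl => hy.eq_jostSolution hV hVi hε hl⟩,
    fun ε hε => ⟨?_, fun y yd hy hl => ?_⟩,
    fun x => ⟨analyticOnNhd_jostSolution hV hVi x, analyticOnNhd_jostSolution hW hWi (-x)⟩⟩
  · obtain ⟨yd, hy⟩ := exists_solvesHom_jostSolution hV hVi hε
    exact ⟨yd, hy, tendsto_exp_mul_jostSolution hV hVi hε⟩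
  · obtain ⟨yd, hy⟩ := exists_solvesHom_jostSolution hW hWi hε
    refine ⟨fun x => -yd (-x), by simpa using hy.comp_neg, ?_⟩
    simpa [Function.comp_def] using
      (tendsto_exp_mul_jostSolution hW hWi hε).comp tendsto_neg_atBot_atTop
  · have h := hy.comp_neg.eq_jostSolution hW hWi hε
      (by simpa [Function.comp_def] using hl.comp tendsto_neg_atTop_atBot)
    funext x
    simpa using congrFun h (-x)
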